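/- arXiv:2403.03353 — 2 statements merged into one kernel-verified Lean document; each statement's English description precedes it below -/
import Mathlib

section
/- The set B_N is a linear subspace of the space of functions from ℝ^s to ℝ^t, and ‖·‖_{B_N} is a well-defined complete norm on B_N; that is, ‖·‖_{B_N} satisfies the triangle inequality and absolute homogeneity, ‖f_μ‖_{B_N} = 0 implies f_μ(x) = 0 for all x ∈ ℝ^s, and B_N endowed with ‖·‖_{B_N} is a Banach space. -/
open MeasureTheory Filter Topology
open scoped ZeroAtInfty BigOperators

noncomputable section

/-- The parameter space of a depth-`D` deep neural network with layer widths
`m 0, m 1, …, m D` (input dimension `m 0 = s`, output dimension `m D = t`). -/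
abbrev Params (m : ℕ → ℕ) (D : ℕ) : Type :=
  (j : Fin D) → ((Fin (m (j.1 + 1)) → Fin (m j.1) → ℝ) × (Fin (m (j.1 + 1)) → ℝ))

/-- The deep neural network `N(x, θ)` of depth `D`, defined recursively by
`N¹(x) = W₁ x + b₁` and `N^{j+1}(x) = W_{j+1} σ(N^j(x)) + b_{j+1}`. -/
def NNet (σ : ℝ → ℝ) (m : ℕ → ℕ) :
    (D : ℕ) → Params m D → (Fin (m 0) → ℝ) → Fin (m D) → ℝ
  | 0, _, x => x
  | 1, θ, x => fun i => (∑ k, (θ ⟨0, Nat.one_pos⟩).1 i k * x k) + (θ ⟨0, Nat.one_pos⟩).2 i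
  | (D + 2), θ, x => fun i =>
      (∑ k, (θ (Fin.last (D + 1))).1 i k *
          σ (NNet σ m (D + 1) (fun j => θ j.castSucc) x k))
        + (θ (Fin.last (D + 1))).2 i

/-- The integral of a function against a finite signed (Radon) measure,
via the Jordan decomposition. -/
def sInt {Θ : Type*} [MeasurableSpace Θ] (μ : SignedMeasure Θ) (f : Θ → ℝ) : ℝ :=
  (∫ θ, f θ ∂μ.toJordanDecomposition.posPart) - ∫ θ, f θ ∂μ.toJordanDecomposition.negPart

/-- The total variation norm of a signed measure. -/
def tvNorm {Θ : Type*} [MeasurableSpace Θ] (μ : SignedMeasure Θ) : ℝ :=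
  (μ.totalVariation Set.univ).toReal

/-- `f_μ^k(x) := ∫_Θ N_k(x,θ) ρ(θ) dμ(θ)`. -/
def fMu (σ : ℝ → ℝ) (m : ℕ → ℕ) (D : ℕ) (ρ : Params m D → ℝ)
    (μ : SignedMeasure (Params m D)) : (Fin (m 0) → ℝ) → Fin (m D) → ℝ :=
  fun x k => sInt μ fun θ => NNet σ m D θ x k * ρ θ

/-- The set `B_N = {f_μ : μ ∈ M(Θ)}`. -/
def BNset (σ : ℝ → ℝ) (m : ℕ → ℕ) (D : ℕ) (ρ : Params m D → ℝ) :
    Set ((Fin (m 0) → ℝ) → Fin (m D) → ℝ) :=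
  {f | ∃ μ : SignedMeasure (Params m D), fMu σ m D ρ μ = f}

/-- The norm `‖f‖_{B_N} = inf {‖ν‖_TV : f_ν = f}`. -/
def BNnorm (σ : ℝ → ℝ) (m : ℕ → ℕ) (D : ℕ) (ρ : Params m D → ℝ)
    (f : (Fin (m 0) → ℝ) → Fin (m D) → ℝ) : ℝ :=
  sInf (tvNorm '' {ν : SignedMeasure (Params m D) | fMu σ m D ρ ν = f})

/-- `S`: the closed linear span in `C₀(Θ)` of the functions `θ ↦ N_k(x,θ)ρ(θ)`
(given here as the bundled family `Kb`). -/
def Sspan (m : ℕ → ℕ) (D : ℕ)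
    (Kb : (Fin (m 0) → ℝ) → Fin (m D) → C₀(Params m D, ℝ)) :
    Submodule ℝ C₀(Params m D, ℝ) :=
  (Submodule.span ℝ
    (Set.range fun p : (Fin (m 0) → ℝ) × Fin (m D) => Kb p.1 p.2)).topologicalClosure

/-- `V_N := span {K_k(x_j, ·) : j, k}`. -/
def VN (m : ℕ → ℕ) (D : ℕ)
    (Kb : (Fin (m 0) → ℝ) → Fin (m D) → C₀(Params m D, ℝ))
    (M : ℕ) (x : Fin M → (Fin (m 0) → ℝ)) : Submodule ℝ C₀(Params m D, ℝ) :=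
  Submodule.span ℝ (Set.range fun p : Fin (m D) × Fin M => Kb (x p.2) p.1)

/-- The interpolation condition `f(x_j) = y_j`, i.e. `f_k(x_j) = y_j^k` for all `j, k`. -/
def interpolates (m : ℕ → ℕ) (D : ℕ) (M : ℕ) (x : Fin M → (Fin (m 0) → ℝ))
    (Y : Fin (m D) → Fin M → ℝ) (f : (Fin (m 0) → ℝ) → Fin (m D) → ℝ) : Prop :=
  ∀ (j : Fin M) (k : Fin (m D)), f (x j) k = Y k j

/-- The solution set `S_{X,Y}` of the MNI problem
`inf {‖f‖_{B_N} : f ∈ B_N, f(x_j) = y_j}`. -/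
def MNISolSet (σ : ℝ → ℝ) (m : ℕ → ℕ) (D : ℕ) (ρ : Params m D → ℝ)
    (M : ℕ) (x : Fin M → (Fin (m 0) → ℝ)) (Y : Fin (m D) → Fin M → ℝ) :
    Set ((Fin (m 0) → ℝ) → Fin (m D) → ℝ) :=
  {f | f ∈ BNset σ m D ρ ∧ interpolates m D M x Y f ∧
    ∀ μ : SignedMeasure (Params m D), interpolates m D M x Y (fMu σ m D ρ μ) →
      BNnorm σ m D ρ f ≤ BNnorm σ m D ρ (fMu σ m D ρ μ)}

/-- The solution set of the measure MNI problem
`inf {‖μ‖_TV : μ ∈ M(Θ), ∫ K_k(x_j,·) dμ = y_j^k}`. -/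
def MeasSolSet (σ : ℝ → ℝ) (m : ℕ → ℕ) (D : ℕ) (ρ : Params m D → ℝ)
    (M : ℕ) (x : Fin M → (Fin (m 0) → ℝ)) (Y : Fin (m D) → Fin M → ℝ) :
    Set (SignedMeasure (Params m D)) :=
  {μ | interpolates m D M x Y (fMu σ m D ρ μ) ∧
    ∀ ν : SignedMeasure (Params m D), interpolates m D M x Y (fMu σ m D ρ ν) →
      tvNorm μ ≤ tvNorm ν}

/-- The subdifferential `∂‖·‖_∞(g) ⊆ B_N` of the supremum norm at `g ∈ S`, viewing `B_N`
as the dual of `S` via the (representation independent) pairing `⟨f_μ, g⟩ = ∫ g dμ`: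
`∂‖·‖_∞(g) = {f_μ ∈ B_N : ‖f_μ‖_{B_N} = 1, ∫ g dμ = ‖g‖_∞}`. -/
def subdiffSup (σ : ℝ → ℝ) (m : ℕ → ℕ) (D : ℕ) (ρ : Params m D → ℝ)
    (g : C₀(Params m D, ℝ)) : Set ((Fin (m 0) → ℝ) → Fin (m D) → ℝ) :=
  {f | f ∈ BNset σ m D ρ ∧ BNnorm σ m D ρ f = 1 ∧
    ∀ μ : SignedMeasure (Params m D), fMu σ m D ρ μ = f → sInt μ (fun θ => g θ) = ‖g‖}

/-- Feasibility for the dual problem: `‖∑_{k,j} c_{kj} K_k(x_j,·)‖_∞ = 1`. -/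
def dualFeasible (m : ℕ → ℕ) (D : ℕ)
    (Kb : (Fin (m 0) → ℝ) → Fin (m D) → C₀(Params m D, ℝ))
    (M : ℕ) (x : Fin M → (Fin (m 0) → ℝ)) (c : Fin (m D) → Fin M → ℝ) : Prop :=
  ‖∑ k, ∑ j, c k j • Kb (x j) k‖ = 1

/-- The objective `∑_{k,j} c_{kj} y_j^k` of the dual problem. -/
def dualObjective (m : ℕ → ℕ) (D : ℕ) (M : ℕ) (Y : Fin (m D) → Fin M → ℝ)
    (c : Fin (m D) → Fin M → ℝ) : ℝ :=
  ∑ k, ∑ j, c k j * Y k j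

/-- `c` is a solution of the dual problem. -/
def dualSolves (m : ℕ → ℕ) (D : ℕ)
    (Kb : (Fin (m 0) → ℝ) → Fin (m D) → C₀(Params m D, ℝ))
    (M : ℕ) (x : Fin M → (Fin (m 0) → ℝ)) (Y : Fin (m D) → Fin M → ℝ)
    (c : Fin (m D) → Fin M → ℝ) : Prop :=
  dualFeasible m D Kb M x c ∧
    ∀ c' : Fin (m D) → Fin M → ℝ, dualFeasible m D Kb M x c' →
      dualObjective m D M Y c' ≤ dualObjective m D M Y c

/-- `ĝ := C* · ∑_{k,j} ĉ_{kj} K_k(x_j,·)`, where `C*` is the optimal dual value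
(the value of the dual objective at the dual solution `c`). -/
def ghat (m : ℕ → ℕ) (D : ℕ)
    (Kb : (Fin (m 0) → ℝ) → Fin (m D) → C₀(Params m D, ℝ))
    (M : ℕ) (x : Fin M → (Fin (m 0) → ℝ)) (Y : Fin (m D) → Fin M → ℝ)
    (c : Fin (m D) → Fin M → ℝ) : C₀(Params m D, ℝ) :=
  dualObjective m D M Y c • ∑ k, ∑ j, c k j • Kb (x j) k

/-- `Θ(g) := {θ ∈ Θ : |g(θ)| = ‖g‖_∞}`. -/
def ThetaSet (m : ℕ → ℕ) (D : ℕ) (g : C₀(Params m D, ℝ)) : Set (Params m D) :=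
  {θ | |g θ| = ‖g‖}

/-- The regularization objective `Q(I_X(f) − Y) + λ ‖f‖_{B_N}`. -/
def regObj (σ : ℝ → ℝ) (m : ℕ → ℕ) (D : ℕ) (ρ : Params m D → ℝ)
    (M : ℕ) (x : Fin M → (Fin (m 0) → ℝ)) (Y : Fin (m D) → Fin M → ℝ)
    (lam : ℝ) (Q : (Fin (m D) → Fin M → ℝ) → ℝ)
    (f : (Fin (m 0) → ℝ) → Fin (m D) → ℝ) : ℝ :=
  Q ((fun k j => f (x j) k) - Y) + lam * BNnorm σ m D ρ f

/-- The solution set `R_{X,Y}` of the regularization problem. -/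
def RegSolSet (σ : ℝ → ℝ) (m : ℕ → ℕ) (D : ℕ) (ρ : Params m D → ℝ)
    (M : ℕ) (x : Fin M → (Fin (m 0) → ℝ)) (Y : Fin (m D) → Fin M → ℝ)
    (lam : ℝ) (Q : (Fin (m D) → Fin M → ℝ) → ℝ) :
    Set ((Fin (m 0) → ℝ) → Fin (m D) → ℝ) :=
  {f | f ∈ BNset σ m D ρ ∧
    ∀ μ : SignedMeasure (Params m D),
      regObj σ m D ρ M x Y lam Q f ≤ regObj σ m D ρ M x Y lam Q (fMu σ m D ρ μ)}

/-- `D_{X,Y} := I_X(R_{X,Y})`. -/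
def DXY (σ : ℝ → ℝ) (m : ℕ → ℕ) (D : ℕ) (ρ : Params m D → ℝ)
    (M : ℕ) (x : Fin M → (Fin (m 0) → ℝ)) (Y : Fin (m D) → Fin M → ℝ)
    (lam : ℝ) (Q : (Fin (m D) → Fin M → ℝ) → ℝ) : Set (Fin (m D) → Fin M → ℝ) :=
  (fun f => fun k j => f (x j) k) '' RegSolSet σ m D ρ M x Y lam Q

/-- If a signed measure is a difference `P - Q` of finite measures, then its integral of a bounded
measurable function is the difference of the integrals. -/
theorem sInt_eq_sub {Θ : Type*} [MeasurableSpace Θ] {μ : SignedMeasure Θ} {P Q : Measure Θ}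
    [IsFiniteMeasure P] [IsFiniteMeasure Q]
    (h : ∀ A, MeasurableSet A → μ A = P.real A - Q.real A)
    {f : Θ → ℝ} (hf : Measurable f) {C : ℝ} (hC : ∀ θ, |f θ| ≤ C) :
    sInt μ f = ∫ θ, f θ ∂P - ∫ θ, f θ ∂Q := by
  have hi : ∀ (κ : Measure Θ) [IsFiniteMeasure κ], Integrable f κ := fun κ _ =>
    Integrable.of_bound hf.aestronglyMeasurable C (Eventually.of_forall hC)
  have hmeas : μ.toJordanDecomposition.posPart + Q = P + μ.toJordanDecomposition.negPart := by
    ext A hA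
    have h1 := h A hA
    rw [μ.apply_eq_posPart_real_sub_negPart_real hA] at h1
    rw [← measureReal_eq_measureReal_iff, measureReal_add_apply, measureReal_add_apply]
    linarith
  have hint := congrArg (fun κ => ∫ θ, f θ ∂κ) hmeas
  simp only [integral_add_measure (hi _) (hi _)] at hint
  unfold sInt
  linarith

theorem tvNorm_eq {Θ : Type*} [MeasurableSpace Θ] (μ : SignedMeasure Θ) :
    tvNorm μ = μ.toJordanDecomposition.posPart.real Set.univ
      + μ.toJordanDecomposition.negPart.real Set.univ := by
  rw [tvNorm, ← measureReal_def, SignedMeasure.totalVariation, measureReal_add_apply]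

theorem tvNorm_nonneg {Θ : Type*} [MeasurableSpace Θ] (μ : SignedMeasure Θ) : 0 ≤ tvNorm μ :=
  ENNReal.toReal_nonneg

/-- If a signed measure is a difference `P - Q` of finite measures, then its total variation norm
is at most the total mass of `P + Q`. -/
theorem tvNorm_le {Θ : Type*} [MeasurableSpace Θ] {μ : SignedMeasure Θ} {P Q : Measure Θ}
    [IsFiniteMeasure P] [IsFiniteMeasure Q]
    (h : ∀ A, MeasurableSet A → μ A = P.real A - Q.real A) :
    tvNorm μ ≤ P.real Set.univ + Q.real Set.univ := by
  obtain ⟨i, hi₁, hi₂, hi₃, hpos, hneg⟩ := μ.toJordanDecomposition_spec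
  rw [tvNorm_eq, hpos, hneg, SignedMeasure.toMeasureOfZeroLE_real_apply _ hi₂ hi₁ .univ,
    SignedMeasure.toMeasureOfLEZero_real_apply _ hi₃ hi₁.compl .univ, Set.inter_univ,
    Set.inter_univ, h _ hi₁, h _ hi₁.compl]
  have h1 := measureReal_add_measureReal_compl (μ := P) hi₁
  have h2 := measureReal_add_measureReal_compl (μ := Q) hi₁
  have h3 : 0 ≤ P.real iᶜ := measureReal_nonneg
  have h4 : 0 ≤ Q.real i := measureReal_nonneg
  linarith

theorem abs_sInt_le {Θ : Type*} [MeasurableSpace Θ] (μ : SignedMeasure Θ) {f : Θ → ℝ} {C : ℝ}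
    (hC : ∀ θ, |f θ| ≤ C) : |sInt μ f| ≤ C * tvNorm μ := by
  have hb : ∀ (κ : Measure Θ) [IsFiniteMeasure κ], |∫ θ, f θ ∂κ| ≤ C * κ.real Set.univ := by
    intro κ _
    rw [← Real.norm_eq_abs]
    exact norm_integral_le_of_norm_le_const (Eventually.of_forall hC)
  rw [tvNorm_eq, mul_add]
  exact (abs_sub _ _).trans (add_le_add (hb _) (hb _))

theorem add_apply_eq_sub {Θ : Type*} [MeasurableSpace Θ] (μ ν : SignedMeasure Θ) :
    ∀ A, MeasurableSet A → (μ + ν) A =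
      (μ.toJordanDecomposition.posPart + ν.toJordanDecomposition.posPart).real A
        - (μ.toJordanDecomposition.negPart + ν.toJordanDecomposition.negPart).real A := by
  intro A hA
  rw [_root_.add_apply, μ.apply_eq_posPart_real_sub_negPart_real hA,
    ν.apply_eq_posPart_real_sub_negPart_real hA, measureReal_add_apply, measureReal_add_apply]
  ring

theorem tvNorm_add_le {Θ : Type*} [MeasurableSpace Θ] (μ ν : SignedMeasure Θ) :
    tvNorm (μ + ν) ≤ tvNorm μ + tvNorm ν := by
  refine (tvNorm_le (add_apply_eq_sub μ ν)).trans_eq ?_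
  rw [tvNorm_eq, tvNorm_eq, measureReal_add_apply, measureReal_add_apply]
  ring

theorem sInt_add {Θ : Type*} [MeasurableSpace Θ] (μ ν : SignedMeasure Θ)
    {f : Θ → ℝ} (hf : Measurable f) {C : ℝ} (hC : ∀ θ, |f θ| ≤ C) :
    sInt (μ + ν) f = sInt μ f + sInt ν f := by
  have hi : ∀ (κ : Measure Θ) [IsFiniteMeasure κ], Integrable f κ := fun κ _ =>
    Integrable.of_bound hf.aestronglyMeasurable C (Eventually.of_forall hC)
  rw [sInt_eq_sub (add_apply_eq_sub μ ν) hf hC, integral_add_measure (hi _) (hi _),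
    integral_add_measure (hi _) (hi _)]
  unfold sInt
  ring

theorem sInt_smul {Θ : Type*} [MeasurableSpace Θ] (c : ℝ) (μ : SignedMeasure Θ) (f : Θ → ℝ) :
    sInt (c • μ) f = c * sInt μ f := by
  unfold sInt
  rw [SignedMeasure.toJordanDecomposition_smul_real]
  rcases le_or_gt 0 c with hc | hc
  · rw [JordanDecomposition.real_smul_posPart_nonneg _ _ hc,
      JordanDecomposition.real_smul_negPart_nonneg _ _ hc, integral_smul_nnreal_measure,
      integral_smul_nnreal_measure]
    simp only [NNReal.smul_def, Real.coe_toNNReal _ hc, smul_eq_mul]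
    ring
  · rw [JordanDecomposition.real_smul_posPart_neg _ _ hc,
      JordanDecomposition.real_smul_negPart_neg _ _ hc, integral_smul_nnreal_measure,
      integral_smul_nnreal_measure]
    simp only [NNReal.smul_def, Real.coe_toNNReal _ (neg_nonneg.2 hc.le), smul_eq_mul]
    ring

theorem tvNorm_smul {Θ : Type*} [MeasurableSpace Θ] (c : ℝ) (μ : SignedMeasure Θ) :
    tvNorm (c • μ) = |c| * tvNorm μ := by
  rw [tvNorm_eq, tvNorm_eq, SignedMeasure.toJordanDecomposition_smul_real]
  rcases le_or_gt 0 c with hc | hc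
  · rw [JordanDecomposition.real_smul_posPart_nonneg _ _ hc,
      JordanDecomposition.real_smul_negPart_nonneg _ _ hc, measureReal_nnreal_smul_apply,
      measureReal_nnreal_smul_apply, Real.coe_toNNReal _ hc, abs_of_nonneg hc]
    ring
  · rw [JordanDecomposition.real_smul_posPart_neg _ _ hc,
      JordanDecomposition.real_smul_negPart_neg _ _ hc, measureReal_nnreal_smul_apply,
      measureReal_nnreal_smul_apply, Real.coe_toNNReal _ (neg_nonneg.2 hc.le), abs_of_neg hc]
    ring

/-- A series of signed measures dominated in total variation by a summable series converges,
tested against bounded measurable functions. -/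
theorem exists_hasSum_sInt {Θ : Type*} [MeasurableSpace Θ] (ν : ℕ → SignedMeasure Θ) {r : ℕ → ℝ}
    (hr : Summable r) (hν : ∀ k, tvNorm (ν k) ≤ r k) :
    ∃ T : SignedMeasure Θ, tvNorm T ≤ ∑' k, r k ∧
      ∀ f : Θ → ℝ, Measurable f → ∀ C : ℝ, (∀ θ, |f θ| ≤ C) →
        HasSum (fun k => sInt (ν k) f) (sInt T f) := by
  have hr0 : ∀ k, 0 ≤ r k := fun k => (tvNorm_nonneg _).trans (hν k)
  set P := Measure.sum fun k => (ν k).toJordanDecomposition.posPart with hP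
  set Q := Measure.sum fun k => (ν k).toJordanDecomposition.negPart with hQ
  have hPQ : P Set.univ + Q Set.univ ≤ ENNReal.ofReal (∑' k, r k) := by
    rw [hP, hQ, Measure.sum_apply _ .univ, Measure.sum_apply _ .univ, ← ENNReal.tsum_add,
      ENNReal.ofReal_tsum_of_nonneg hr0 hr]
    refine ENNReal.tsum_le_tsum fun k => ?_
    rw [← Measure.add_apply]
    exact (ENNReal.le_ofReal_iff_toReal_le (measure_ne_top (ν k).totalVariation _) (hr0 k)).2 (hν k)
  have : IsFiniteMeasure P := ⟨(le_self_add.trans hPQ).trans_lt ENNReal.ofReal_lt_top⟩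
  have : IsFiniteMeasure Q := ⟨(le_add_self.trans hPQ).trans_lt ENNReal.ofReal_lt_top⟩
  have hT : ∀ A, MeasurableSet A →
      (P.toSignedMeasure - Q.toSignedMeasure) A = P.real A - Q.real A :=
    fun A hA => Measure.toSignedMeasure_sub_apply hA
  refine ⟨P.toSignedMeasure - Q.toSignedMeasure, (tvNorm_le hT).trans ?_, fun f hf C hC => ?_⟩
  · rw [measureReal_def, measureReal_def,
      ← ENNReal.toReal_add (measure_ne_top _ _) (measure_ne_top _ _)]
    exact ENNReal.toReal_le_of_le_ofReal (tsum_nonneg hr0) hPQ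
  · have hi : ∀ (κ : Measure Θ) [IsFiniteMeasure κ], Integrable f κ := fun κ _ =>
      Integrable.of_bound hf.aestronglyMeasurable C (Eventually.of_forall hC)
    rw [sInt_eq_sub hT hf hC]
    exact (hasSum_integral_measure (hi P)).sub (hasSum_integral_measure (hi Q))

theorem BNnorm_fMu_le (σ : ℝ → ℝ) (m : ℕ → ℕ) (D : ℕ) (ρ : Params m D → ℝ)
    (μ : SignedMeasure (Params m D)) : BNnorm σ m D ρ (fMu σ m D ρ μ) ≤ tvNorm μ :=
  csInf_le ⟨0, by rintro _ ⟨ν, -, rfl⟩; exact tvNorm_nonneg ν⟩ ⟨μ, rfl, rfl⟩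

/-- Measures representing `f` have total variation arbitrarily close to `‖f‖_{B_N}`. -/
theorem exists_tvNorm_lt {σ : ℝ → ℝ} {m : ℕ → ℕ} {D : ℕ} {ρ : Params m D → ℝ}
    {f : (Fin (m 0) → ℝ) → Fin (m D) → ℝ} (hf : f ∈ BNset σ m D ρ) {a : ℝ}
    (ha : BNnorm σ m D ρ f < a) :
    ∃ μ : SignedMeasure (Params m D), fMu σ m D ρ μ = f ∧ tvNorm μ < a := by
  obtain ⟨μ, hμ⟩ := hf
  obtain ⟨_, ⟨ν, hν, rfl⟩, hlt⟩ := exists_lt_of_csInf_lt (Set.Nonempty.image _ ⟨μ, hμ⟩) ha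
  exact ⟨ν, hν, hlt⟩

theorem fMu_smul (σ : ℝ → ℝ) (m : ℕ → ℕ) (D : ℕ) (ρ : Params m D → ℝ) (c : ℝ)
    (μ : SignedMeasure (Params m D)) : fMu σ m D ρ (c • μ) = c • fMu σ m D ρ μ :=
  funext fun _ => funext fun _ => sInt_smul _ _ _

theorem BNnorm_smul_le {σ : ℝ → ℝ} {m : ℕ → ℕ} {D : ℕ} {ρ : Params m D → ℝ} (c : ℝ)
    {f : (Fin (m 0) → ℝ) → Fin (m D) → ℝ} (hf : f ∈ BNset σ m D ρ) :
    BNnorm σ m D ρ (c • f) ≤ |c| * BNnorm σ m D ρ f := by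
  have key : ∀ a, BNnorm σ m D ρ f < a → BNnorm σ m D ρ (c • f) ≤ |c| * a := by
    intro a ha
    obtain ⟨μ, rfl, hlt⟩ := exists_tvNorm_lt hf ha
    rw [← fMu_smul]
    refine (BNnorm_fMu_le σ m D ρ _).trans ?_
    rw [tvNorm_smul]
    gcongr
  refine ge_of_tendsto (f := fun a : ℝ => |c| * a) (x := 𝓝[>] (BNnorm σ m D ρ f)) ?_
    (eventually_nhdsWithin_of_forall key)
  exact ((continuous_const.mul continuous_id).tendsto _).mono_left nhdsWithin_le_nhds

theorem BNnorm_nonneg (σ : ℝ → ℝ) (m : ℕ → ℕ) (D : ℕ) (ρ : Params m D → ℝ)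
    (f : (Fin (m 0) → ℝ) → Fin (m D) → ℝ) : 0 ≤ BNnorm σ m D ρ f :=
  Real.sInf_nonneg (by rintro _ ⟨ν, -, rfl⟩; exact tvNorm_nonneg ν)

theorem smul_mem_BNset {σ : ℝ → ℝ} {m : ℕ → ℕ} {D : ℕ} {ρ : Params m D → ℝ} (c : ℝ)
    {f : (Fin (m 0) → ℝ) → Fin (m D) → ℝ} (hf : f ∈ BNset σ m D ρ) : c • f ∈ BNset σ m D ρ := by
  obtain ⟨μ, rfl⟩ := hf
  exact ⟨c • μ, fMu_smul ..⟩

theorem BNnorm_smul {σ : ℝ → ℝ} {m : ℕ → ℕ} {D : ℕ} {ρ : Params m D → ℝ} (c : ℝ)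
    {f : (Fin (m 0) → ℝ) → Fin (m D) → ℝ} (hf : f ∈ BNset σ m D ρ) :
    BNnorm σ m D ρ (c • f) = |c| * BNnorm σ m D ρ f := by
  refine (BNnorm_smul_le c hf).antisymm ?_
  rcases eq_or_ne c 0 with rfl | hc
  · simpa using BNnorm_nonneg σ m D ρ _
  have h := BNnorm_smul_le c⁻¹ (smul_mem_BNset c hf)
  rw [inv_smul_smul₀ hc, abs_inv] at h
  have hpos : 0 < |c| := abs_pos.2 hc
  calc |c| * BNnorm σ m D ρ f ≤ |c| * (|c|⁻¹ * BNnorm σ m D ρ (c • f)) := by gcongr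
    _ = BNnorm σ m D ρ (c • f) := mul_inv_cancel_left₀ hpos.ne' _

/-- `B_N` is a linear subspace of the space of functions `ℝ^s → ℝ^t`,
and `‖·‖_{B_N}` is a well-defined complete norm on it: it satisfies the triangle
inequality and absolute homogeneity, `‖f‖_{B_N} = 0` implies `f = 0`, and every Cauchy
sequence in `B_N` (w.r.t. `‖·‖_{B_N}`) converges in `B_N`. -/
theorem statement_3
    (σ : ℝ → ℝ) (hσ : Continuous σ) (m : ℕ → ℕ) (D : ℕ) (hD : 0 < D)
    (ρ : Params m D → ℝ) (hρc : Continuous ρ) (hρpos : ∀ θ, 0 < ρ θ)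
    (Kb : (Fin (m 0) → ℝ) → Fin (m D) → C₀(Params m D, ℝ))
    (hKb : ∀ x k θ, Kb x k θ = NNet σ m D θ x k * ρ θ) :
    (∃ S : Submodule ℝ ((Fin (m 0) → ℝ) → Fin (m D) → ℝ), (S : Set _) = BNset σ m D ρ)
    ∧ (∀ f ∈ BNset σ m D ρ, ∀ g ∈ BNset σ m D ρ,
        BNnorm σ m D ρ (f + g) ≤ BNnorm σ m D ρ f + BNnorm σ m D ρ g)
    ∧ (∀ (c : ℝ), ∀ f ∈ BNset σ m D ρ, BNnorm σ m D ρ (c • f) = |c| * BNnorm σ m D ρ f)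
    ∧ (∀ f ∈ BNset σ m D ρ, BNnorm σ m D ρ f = 0 → ∀ x : Fin (m 0) → ℝ, f x = 0)
    ∧ ∀ u : ℕ → ((Fin (m 0) → ℝ) → Fin (m D) → ℝ), (∀ i, u i ∈ BNset σ m D ρ) →
        (∀ ε : ℝ, 0 < ε → ∃ N : ℕ, ∀ p ≥ N, ∀ q ≥ N, BNnorm σ m D ρ (u p - u q) < ε) →
        ∃ f ∈ BNset σ m D ρ,
          ∀ ε : ℝ, 0 < ε → ∃ N : ℕ, ∀ p ≥ N, BNnorm σ m D ρ (u p - f) < ε := by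
  have habs : ∀ x k θ, |NNet σ m D θ x k * ρ θ| ≤ ‖Kb x k‖ := by
    intro x k θ
    rw [← hKb]
    exact (Kb x k).toBCF.norm_coe_le_norm θ
  have hmeas : ∀ x k, Measurable fun θ => NNet σ m D θ x k * ρ θ := by
    intro x k
    simp_rw [← hKb]
    exact (Kb x k).continuous.measurable
  have fMu_add : ∀ μ ν, fMu σ m D ρ (μ + ν) = fMu σ m D ρ μ + fMu σ m D ρ ν := fun μ ν =>
    funext fun x => funext fun k => sInt_add μ ν (hmeas x k) (habs x k)
  have add_mem : ∀ f ∈ BNset σ m D ρ, ∀ g ∈ BNset σ m D ρ, f + g ∈ BNset σ m D ρ := by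
    rintro _ ⟨μ, rfl⟩ _ ⟨ν, rfl⟩
    exact ⟨μ + ν, fMu_add μ ν⟩
  have sub_mem : ∀ f ∈ BNset σ m D ρ, ∀ g ∈ BNset σ m D ρ, f - g ∈ BNset σ m D ρ := by
    intro f hf g hg
    rw [sub_eq_add_neg, ← neg_one_smul ℝ g]
    exact add_mem _ hf _ (smul_mem_BNset _ hg)
  have norm_add : ∀ f ∈ BNset σ m D ρ, ∀ g ∈ BNset σ m D ρ,
      BNnorm σ m D ρ (f + g) ≤ BNnorm σ m D ρ f + BNnorm σ m D ρ g := by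
    intro f hf g hg
    refine le_of_forall_pos_le_add fun ε hε => ?_
    obtain ⟨μ, hμ, hμlt⟩ := exists_tvNorm_lt hf (lt_add_of_pos_right _ (half_pos hε))
    obtain ⟨ν, hν, hνlt⟩ := exists_tvNorm_lt hg (lt_add_of_pos_right _ (half_pos hε))
    have h := (BNnorm_fMu_le σ m D ρ (μ + ν)).trans (tvNorm_add_le μ ν)
    rw [fMu_add, hμ, hν] at h
    linarith
  refine ⟨⟨⟨⟨⟨BNset σ m D ρ, fun {f g} hf hg => add_mem f hf g hg⟩, ?_⟩,
    fun c _ hf => smul_mem_BNset c hf⟩, rfl⟩, norm_add, fun c f hf => BNnorm_smul c hf,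
    fun f hf h0 x => funext fun k => ?_, fun u hu hcauchy => ?_⟩
  · have h := smul_mem_BNset (σ := σ) (ρ := ρ) (0 : ℝ) ⟨0, rfl⟩
    rwa [zero_smul] at h
  · have hle : ∀ a, 0 < a → |f x k| ≤ ‖Kb x k‖ * a := by
      intro a ha
      obtain ⟨μ, rfl, hlt⟩ := exists_tvNorm_lt hf (h0.trans_lt ha)
      refine (abs_sInt_le μ (habs x k)).trans ?_
      gcongr
    have hlim : Tendsto (fun a : ℝ => ‖Kb x k‖ * a) (𝓝[>] 0) (𝓝 (‖Kb x k‖ * 0)) :=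
      ((continuous_const.mul continuous_id).tendsto _).mono_left nhdsWithin_le_nhds
    have h := ge_of_tendsto hlim (eventually_nhdsWithin_of_forall hle)
    rw [mul_zero] at h
    exact abs_nonpos_iff.1 h
  · choose N hN using fun k : ℕ => hcauchy ((1 / 2) ^ k) (by positivity)
    set φ : ℕ → ℕ := fun k => ∑ i ∈ Finset.range (k + 1), N i with hφ
    have hNφ : ∀ k, N k ≤ φ k := fun k =>
      Finset.single_le_sum (fun _ _ => Nat.zero_le _) (Finset.self_mem_range_succ k)
    have hφmono : ∀ k, φ k ≤ φ (k + 1) := fun k => by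
      simp only [hφ]
      rw [Finset.sum_range_succ _ (k + 1)]
      exact Nat.le_add_right _ _
    choose ν hν hνlt using fun k => exists_tvNorm_lt (sub_mem _ (hu (φ (k + 1))) _ (hu (φ k)))
      (hN k _ ((hNφ k).trans (hφmono k)) _ (hNφ k))
    have hsum : ∀ n : ℕ, HasSum (fun k : ℕ => (1 / 2 : ℝ) ^ (k + n)) (2 * (1 / 2) ^ n) := by
      intro n
      simpa only [pow_add] using hasSum_geometric_two.mul_right ((1 / 2 : ℝ) ^ n)
    choose T hTtv hTsum using fun n : ℕ => exists_hasSum_sInt (fun k => ν (k + n))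
      (hsum n).summable fun k => (hνlt (k + n)).le
    have hlim : ∀ n x k, Tendsto (fun j => u (φ j) x k) atTop
        (𝓝 (u (φ n) x k + fMu σ m D ρ (T n) x k)) := by
      intro n x k
      refine (tendsto_add_atTop_iff_nat n).1 ?_
      have h := (hTsum n _ (hmeas x k) _ (habs x k)).tendsto_sum_nat.const_add (u (φ n) x k)
      refine h.congr fun j => ?_
      have hterm : ∀ i, sInt (ν (i + n)) (fun θ => NNet σ m D θ x k * ρ θ)
          = u (φ (i + 1 + n)) x k - u (φ (i + n)) x k := by
        intro i
        rw [add_right_comm]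
        exact congrFun (congrFun (hν (i + n)) x) k
      simp_rw [hterm]
      rw [Finset.sum_range_sub (fun i => u (φ (i + n)) x k)]
      simp
    have hf : ∀ n, u (φ 0) + fMu σ m D ρ (T 0) = u (φ n) + fMu σ m D ρ (T n) := fun n =>
      funext fun x => funext fun k => tendsto_nhds_unique (hlim 0 x k) (hlim n x k)
    refine ⟨u (φ 0) + fMu σ m D ρ (T 0), add_mem _ (hu _) _ ⟨_, rfl⟩, fun ε hε => ?_⟩
    obtain ⟨n, hn⟩ := exists_pow_lt_of_lt_one (show 0 < ε / 3 by positivity)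
      (show (1 / 2 : ℝ) < 1 by norm_num)
    refine ⟨φ n, fun p hp => ?_⟩
    have h1 := hN n p ((hNφ n).trans hp) (φ n) (hNφ n)
    have h2 := norm_add _ (sub_mem _ (hu p) _ (hu (φ n))) _
      (smul_mem_BNset (-1) ⟨T n, rfl⟩)
    have h3 := (BNnorm_fMu_le σ m D ρ (T n)).trans ((hTtv n).trans_eq (hsum n).tsum_eq)
    rw [BNnorm_smul _ ⟨T n, rfl⟩, abs_neg, abs_one, one_mul] at h2
    rw [hf n, ← sub_sub, sub_eq_add_neg (u p - u (φ n)), ← neg_one_smul ℝ (fMu _ _ _ _ (T n))]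
    linarith

end
end

section
/- Suppose m distinct points x_1,…,x_m ∈ ℝ^s are given, Y = [y_j^k] ∈ ℝ^{t×m}, Y ≠ 0, and the functions K_k(x_j,·), j ∈ {1,…,m}, k ∈ {1,…,t}, are linearly independent in C₀(Θ). Then the dual problem sup{ Σ_{k=1}^t Σ_{j=1}^m c_{kj} y_j^k : c = [c_{kj}] ∈ ℝ^{t×m}, ‖Σ_{k=1}^t Σ_{j=1}^m c_{kj} K_k(x_j,·)‖_∞ = 1 } has a solution; that is, there exists ĉ ∈ ℝ^{t×m} with ‖Σ_{k,j} ĉ_{kj} K_k(x_j,·)‖_∞ = 1 attaining the supremum. -/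
open MeasureTheory Filter Topology
open scoped ZeroAtInfty BigOperators

noncomputable section

/-- A continuous real function attains its maximum on the preimage of the unit sphere under an
injective linear map from a nontrivial finite-dimensional normed space. -/
theorem exists_isMaxOn_norm_eq_one {E F : Type*} [NormedAddCommGroup E] [NormedSpace ℝ E]
    [FiniteDimensional ℝ E] [Nontrivial E] [NormedAddCommGroup F] [NormedSpace ℝ F]
    (T : E →ₗ[ℝ] F) (hT : Function.Injective T) {f : E → ℝ} (hf : Continuous f) :
    ∃ c, ‖T c‖ = 1 ∧ ∀ c', ‖T c'‖ = 1 → f c' ≤ f c := by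
  have hker : LinearMap.ker T = ⊥ := LinearMap.ker_eq_bot.2 hT
  obtain ⟨K, -, hK⟩ := T.exists_antilipschitzWith hker
  have hcont : Continuous T := T.continuous_of_finiteDimensional
  have hcompact : IsCompact (T ⁻¹' Metric.sphere 0 1) :=
    Metric.isCompact_of_isClosed_isBounded (Metric.isClosed_sphere.preimage hcont)
      (hK.isBounded_preimage Metric.isBounded_sphere)
  have hne : (T ⁻¹' Metric.sphere 0 1).Nonempty := by
    obtain ⟨v, hv⟩ := exists_ne (0 : E)
    have hTv : ‖T v‖ ≠ 0 := norm_ne_zero_iff.2 ((map_ne_zero_iff T hT).2 hv)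
    refine ⟨‖T v‖⁻¹ • v, ?_⟩
    simp [norm_smul, hTv]
  obtain ⟨c, hc, hmax⟩ := hcompact.exists_isMaxOn hne hf.continuousOn
  exact ⟨c, by simpa using hc, fun c' hc' => hmax (by simpa using hc')⟩

/-- If the kernel sections `K_k(x_j,·)` are linearly independent in
`C₀(Θ)` and `Y ≠ 0`, then the dual problem
`sup {∑_{k,j} c_{kj} y_j^k : ‖∑_{k,j} c_{kj} K_k(x_j,·)‖_∞ = 1}` has a solution. -/
theorem statement_10
    (σ : ℝ → ℝ) (hσ : Continuous σ) (m : ℕ → ℕ) (D : ℕ) (hD : 0 < D)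
    (ρ : Params m D → ℝ) (hρc : Continuous ρ) (hρpos : ∀ θ, 0 < ρ θ)
    (Kb : (Fin (m 0) → ℝ) → Fin (m D) → C₀(Params m D, ℝ))
    (hKb : ∀ x k θ, Kb x k θ = NNet σ m D θ x k * ρ θ)
    (M : ℕ) (x : Fin M → (Fin (m 0) → ℝ)) (hx : Function.Injective x)
    (Y : Fin (m D) → Fin M → ℝ) (hY : Y ≠ 0)
    (hLI : LinearIndependent ℝ (fun p : Fin (m D) × Fin M => Kb (x p.2) p.1)) :
    ∃ c : Fin (m D) → Fin M → ℝ, dualSolves m D Kb M x Y c := by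
  have : Nontrivial (Fin (m D) → Fin M → ℝ) := ⟨⟨Y, 0, hY⟩⟩
  let T : (Fin (m D) → Fin M → ℝ) →ₗ[ℝ] C₀(Params m D, ℝ) :=
    { toFun := fun c => ∑ k, ∑ j, c k j • Kb (x j) k
      map_add' := fun c d => by
        have h (k j) : (c + d) k j • Kb (x j) k = c k j • Kb (x j) k + d k j • Kb (x j) k :=
          add_smul (c k j) (d k j) (Kb (x j) k)
        simp_rw [h, Finset.sum_add_distrib]
      map_smul' := fun a c => by simp [mul_smul, Finset.smul_sum] }
  have hT : Function.Injective T := by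
    refine (injective_iff_map_eq_zero T).2 fun c hc => ?_
    have hsum : ∑ p : Fin (m D) × Fin M, c p.1 p.2 • Kb (x p.2) p.1 = 0 :=
      (Fintype.sum_prod_type _).trans hc
    funext k j
    exact Fintype.linearIndependent_iff.1 hLI (fun p => c p.1 p.2) hsum (k, j)
  have hf : Continuous (dualObjective m D M Y) := by
    unfold dualObjective
    fun_prop
  exact exists_isMaxOn_norm_eq_one T hT hf

end
end
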